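/- arXiv:1408.5738 — 8 statements merged into one kernel-verified Lean document; each statement's English description precedes it below -/
import Mathlib

section
/- Suppose 𝒜₁ ∈ ℝ^{n_x×n_x} is Hurwitz, i.e., every eigenvalue of 𝒜₁ has strictly negative real part. Then for any matrices 𝓑₁ ∈ ℝ^{n_x×n_e}, 𝒜₂ ∈ ℝ^{n_e×n_x}, and C̄_p ∈ ℝ^{n_y×n_x}, there exist ε₁, ε₂, μ > 0 and a symmetric positive definite matrix P ∈ ℝ^{n_x×n_x} such that the block matrix [[𝒜₁ᵀP + P𝒜₁ + 𝒜₂ᵀ𝒜₂ + ε₁C̄_pᵀC̄_p + ε₂I_{n_x}, P𝓑₁], [𝓑₁ᵀP, −μI_{n_e}]] is negative semidefinite. -/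
open Matrix

/-- `S ⪯ 0`: a real matrix is negative semidefinite if `zᵀ S z ≤ 0` for all real vectors `z`. -/
def Matrix.NegSemidefR {m : Type*} [Fintype m] (S : Matrix m m ℝ) : Prop :=
  ∀ z : m → ℝ, z ⬝ᵥ S.mulVec z ≤ 0

/-- A real square matrix is Hurwitz if all of its complex eigenvalues have strictly
negative real part. -/
def Matrix.IsHurwitz {m : Type*} [Fintype m] [DecidableEq m] (A : Matrix m m ℝ) : Prop :=
  ∀ z : ℂ, z ∈ spectrum ℂ (A.map (Complex.ofReal ·)) → z.re < 0

open Filter Topology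
open scoped Matrix.Norms.L2Operator

/-- A small forward Euler step keeps the spectrum of a Hurwitz matrix inside the unit disc. -/
theorem Matrix.IsHurwitz.exists_step {n : Type*} [Fintype n] [DecidableEq n]
    {A : Matrix n n ℝ} (hA : A.IsHurwitz) :
    ∃ h : ℝ, 0 < h ∧
      ∀ z ∈ spectrum ℂ ((1 + h • A).map (Complex.ofReal ·)), ‖z‖ < 1 := by
  have hfin := Matrix.finite_spectrum (A.map (Complex.ofReal ·))
  have key : ∀ z ∈ spectrum ℂ (A.map (Complex.ofReal ·)),
      ∀ᶠ h : ℝ in 𝓝[>] 0, ‖1 + (h : ℂ) * z‖ < 1 := by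
    intro z hz
    have hre := hA z hz
    have hlim : Tendsto (fun h : ℝ => 2 * z.re + h * Complex.normSq z) (𝓝[>] 0)
        (𝓝 (2 * z.re)) := by
      have hcont : Continuous fun h : ℝ => 2 * z.re + h * Complex.normSq z := by fun_prop
      simpa using (hcont.tendsto 0).mono_left nhdsWithin_le_nhds
    filter_upwards [hlim.eventually_lt_const (by linarith : 2 * z.re < 0),
      self_mem_nhdsWithin] with h hneg hpos
    have hpos : 0 < h := hpos
    rw [← sq_lt_one_iff₀ (norm_nonneg _), ← Complex.normSq_eq_norm_sq]
    have hexp : Complex.normSq (1 + (h : ℂ) * z) =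
        1 + h * (2 * z.re + h * Complex.normSq z) := by
      simp [Complex.normSq_apply]
      ring
    rw [hexp]
    nlinarith [mul_pos hpos (neg_pos.mpr hneg)]
  obtain ⟨h, hh, hpos⟩ := (((eventually_all_finite hfin).mpr key).and self_mem_nhdsWithin).exists
  have hpos : 0 < h := hpos
  have hne : (h : ℂ) ≠ 0 := by exact_mod_cast hpos.ne'
  refine ⟨h, hpos, fun z hz => ?_⟩
  have hmap : (1 + h • A).map (Complex.ofReal ·) =
      algebraMap ℂ (Matrix n n ℂ) 1 + Units.mk0 (h : ℂ) hne • A.map (Complex.ofReal ·) := by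
    ext i j
    simp [Matrix.one_apply, Units.smul_def, apply_ite Complex.ofReal]
  rw [hmap, ← spectrum.singleton_add_eq, spectrum.unit_smul_eq_smul] at hz
  obtain ⟨_, rfl, _, ⟨w, hw, rfl⟩, rfl⟩ := hz
  exact hh w hw

/-- Powers of an element of spectral radius less than one eventually have norm less than one. -/
theorem spectrum.exists_norm_pow_succ_lt_one {R : Type*} [NormedRing R] [NormedAlgebra ℂ R]
    [CompleteSpace R] {a : R} (ha : ∀ z ∈ spectrum ℂ a, ‖z‖ < 1) :
    ∃ N : ℕ, ‖a ^ (N + 1)‖ < 1 := by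
  rcases subsingleton_or_nontrivial R with hR | hR
  · exact ⟨0, by rw [Subsingleton.elim (a ^ (0 + 1)) 0, norm_zero]; exact one_pos⟩
  have hrad : spectralRadius ℂ a < (1 : NNReal) :=
    spectrum.spectralRadius_lt_of_forall_lt a fun z hz => by exact_mod_cast ha z hz
  have hev := (spectrum.pow_nnnorm_pow_one_div_tendsto_nhds_spectralRadius a).eventually_lt_const
    hrad
  obtain ⟨N, hN, hN1⟩ := (hev.and (eventually_ge_atTop 1)).exists
  obtain ⟨k, rfl⟩ := Nat.exists_eq_add_of_le' hN1
  refine ⟨k, ?_⟩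
  by_contra! hge
  have hge' : (1 : ENNReal) ≤ ‖a ^ (k + 1)‖₊ := by exact_mod_cast hge
  exact absurd hN (not_lt.mpr (by
    simpa using ENNReal.one_le_rpow hge' (by positivity : (0 : ℝ) < 1 / ((k + 1 : ℕ) : ℝ))))

theorem EuclideanSpace.norm_toLp_ofReal_sq {n : Type*} [Fintype n] (w : n → ℝ) :
    ‖(WithLp.toLp 2 (fun i => (w i : ℂ)) : EuclideanSpace ℂ n)‖ ^ 2 = w ⬝ᵥ w := by
  rw [EuclideanSpace.norm_sq_eq]
  simp [dotProduct, sq]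

theorem Matrix.dotProduct_transpose_mul_self_mulVec {m n : Type*} [Fintype m] [Fintype n]
    (M : Matrix m n ℝ) (z : n → ℝ) : z ⬝ᵥ (Mᵀ * M) *ᵥ z = M *ᵥ z ⬝ᵥ M *ᵥ z := by
  rw [← Matrix.mulVec_mulVec, Matrix.dotProduct_mulVec, Matrix.vecMul_transpose]

/-- The complex operator norm bounds the Euclidean gain of a real matrix. -/
theorem Matrix.mulVec_dotProduct_self_le {m n : Type*} [Fintype m] [Fintype n] [DecidableEq n]
    (M : Matrix m n ℝ) (z : n → ℝ) :
    M *ᵥ z ⬝ᵥ M *ᵥ z ≤ ‖M.map (Complex.ofReal ·)‖ ^ 2 * (z ⬝ᵥ z) := by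
  have hmul : M.map (Complex.ofReal ·) *ᵥ (fun i => (z i : ℂ)) =
      fun i => ((M *ᵥ z) i : ℂ) := by
    ext i
    simp [Matrix.mulVec, dotProduct]
  have hle := Matrix.l2_opNorm_mulVec (M.map (Complex.ofReal ·))
    (WithLp.toLp 2 (fun i => (z i : ℂ)))
  have hle2 := pow_le_pow_left₀ (norm_nonneg _) hle 2
  rw [mul_pow, EuclideanSpace.norm_toLp_ofReal_sq z] at hle2
  rw [← EuclideanSpace.norm_toLp_ofReal_sq (M *ᵥ z), ← hmul]
  exact hle2

/-- **Lyapunov's theorem**: a Hurwitz matrix admits a quadratic Lyapunov function. -/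
theorem Matrix.IsHurwitz.exists_lyapunov {n : Type*} [Fintype n] [DecidableEq n]
    {A : Matrix n n ℝ} (hA : A.IsHurwitz) :
    ∃ (P : Matrix n n ℝ) (c : ℝ), P.PosDef ∧ 0 < c ∧
      ∀ z : n → ℝ, z ⬝ᵥ (Aᵀ * P + P * A) *ᵥ z ≤ -c * (z ⬝ᵥ z) := by
  obtain ⟨h, hpos, hspec⟩ := hA.exists_step
  obtain ⟨N, hN⟩ := spectrum.exists_norm_pow_succ_lt_one hspec
  set D : Matrix n n ℝ := 1 + h • A with hD
  have hNmap : D.map (Complex.ofReal ·) ^ (N + 1) = (D ^ (N + 1)).map (Complex.ofReal ·) :=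
    (map_pow Complex.ofRealHom.mapMatrix D (N + 1)).symm
  rw [hNmap] at hN
  set r := ‖(D ^ (N + 1)).map (Complex.ofReal ·)‖
  set P : Matrix n n ℝ := ∑ k ∈ Finset.range (N + 1), (D ^ k)ᵀ * D ^ k with hP
  have hpsd : ∀ s : Finset ℕ, (∑ k ∈ s, (D ^ (k + 1))ᵀ * D ^ (k + 1)).PosSemidef := fun s =>
    Matrix.posSemidef_sum s fun k _ => Matrix.posSemidef_conjTranspose_mul_self (D ^ (k + 1))
  have hPD : P.PosDef := by
    rw [hP, Finset.sum_range_succ']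
    simpa using Matrix.PosDef.posSemidef_add (hpsd _) (Matrix.PosDef.one (n := n) (R := ℝ))
  have htele : Dᵀ * P * D = P + (D ^ (N + 1))ᵀ * D ^ (N + 1) - 1 := by
    have hshift : Dᵀ * P * D =
        ∑ k ∈ Finset.range (N + 1), (D ^ (k + 1))ᵀ * D ^ (k + 1) := by
      rw [hP, Finset.mul_sum, Finset.sum_mul]
      refine Finset.sum_congr rfl fun k _ => ?_
      rw [pow_succ, Matrix.transpose_mul]
      simp only [Matrix.mul_assoc]
    have hsucc := Finset.sum_range_succ (fun k => (D ^ k)ᵀ * D ^ k) (N + 1)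
    rw [Finset.sum_range_succ'] at hsucc
    rw [hshift, hP, ← hsucc]
    simp
  have hexp : Dᵀ * P * D = P + h • (Aᵀ * P + P * A) + (h * h) • (Aᵀ * P * A) := by
    simp only [hD, Matrix.transpose_add, Matrix.transpose_one, Matrix.transpose_smul, add_mul,
      mul_add, one_mul, mul_one, smul_mul_assoc, mul_smul_comm, smul_add, smul_smul]
    abel
  refine ⟨P, (1 - r ^ 2) / h, hPD, div_pos (by nlinarith [norm_nonneg ((D ^ (N + 1)).map
    (Complex.ofReal ·))]) hpos, fun z => ?_⟩
  have hq := congrArg (fun M : Matrix n n ℝ => z ⬝ᵥ M *ᵥ z) (hexp.symm.trans htele)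
  have hAPA : 0 ≤ z ⬝ᵥ (Aᵀ * P * A) *ᵥ z := by
    have := (hPD.posSemidef.conjTranspose_mul_mul_same A).dotProduct_mulVec_nonneg z
    simpa using this
  have hE := Matrix.mulVec_dotProduct_self_le (D ^ (N + 1)) z
  simp only [Matrix.add_mulVec, Matrix.sub_mulVec, Matrix.smul_mulVec, dotProduct_add,
    dotProduct_sub, dotProduct_smul, smul_eq_mul, Matrix.one_mulVec,
    Matrix.dotProduct_transpose_mul_self_mulVec] at hq
  simp only [Matrix.add_mulVec, dotProduct_add]
  rw [neg_mul, div_mul_eq_mul_div, ← neg_div, le_div_iff₀ hpos]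
  nlinarith [mul_nonneg (mul_pos hpos hpos).le hAPA]

/-- If `𝒜₁` is Hurwitz then the LMI of Proposition 1 is solvable: there exist
`ε₁, ε₂, μ > 0` and a symmetric positive definite `P` such that the block matrix
`[[𝒜₁ᵀP + P𝒜₁ + 𝒜₂ᵀ𝒜₂ + ε₁C̄_pᵀC̄_p + ε₂I, P𝓑₁], [𝓑₁ᵀP, −μI]]` is negative semidefinite. -/
theorem hurwitz_implies_lmi_solvable {nx ne ny : ℕ}
    (A1 : Matrix (Fin nx) (Fin nx) ℝ) (hA1 : A1.IsHurwitz)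
    (B1 : Matrix (Fin nx) (Fin ne) ℝ) (A2 : Matrix (Fin ne) (Fin nx) ℝ)
    (Cp : Matrix (Fin ny) (Fin nx) ℝ) :
    ∃ (ε₁ ε₂ μ : ℝ) (P : Matrix (Fin nx) (Fin nx) ℝ),
      0 < ε₁ ∧ 0 < ε₂ ∧ 0 < μ ∧ P.IsSymm ∧ P.PosDef ∧
      (Matrix.fromBlocks
        (A1ᵀ * P + P * A1 + A2ᵀ * A2 + ε₁ • (Cpᵀ * Cp) + ε₂ • (1 : Matrix (Fin nx) (Fin nx) ℝ))
        (P * B1) (B1ᵀ * P) (-μ • (1 : Matrix (Fin ne) (Fin ne) ℝ))).NegSemidefR := by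
  obtain ⟨P₀, c, hP₀, hc, hlyap⟩ := hA1.exists_lyapunov
  set K₁ := ‖A2.map (Complex.ofReal ·)‖ ^ 2
  set K₂ := ‖Cp.map (Complex.ofReal ·)‖ ^ 2
  set s := (K₁ + K₂ + 2) / c
  have hspos : 0 < s := by positivity
  have hsc : s * c = K₁ + K₂ + 2 := div_mul_cancel₀ _ hc.ne'
  set P := s • P₀ with hP
  have hPD : P.PosDef := hP₀.smul hspos
  have hPsymm : Pᵀ = P := by simpa using hPD.isHermitian.eq
  set K₃ := ‖(P * B1).map (Complex.ofReal ·)‖ ^ 2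
  refine ⟨1, 1, K₃ + 1, P, one_pos, one_pos, by positivity, hPsymm, hPD, fun z => ?_⟩
  obtain ⟨x, y, rfl⟩ : ∃ x y, z = Sum.elim x y := ⟨_, _, (Sum.elim_comp_inl_inr z).symm⟩
  have hlyap' : x ⬝ᵥ (A1ᵀ * P + P * A1) *ᵥ x ≤ -(K₁ + K₂ + 2) * (x ⬝ᵥ x) := by
    have hscale : A1ᵀ * P + P * A1 = s • (A1ᵀ * P₀ + P₀ * A1) := by
      simp [hP, smul_add]
    rw [hscale, Matrix.smul_mulVec, dotProduct_smul, smul_eq_mul, ← hsc]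
    nlinarith [mul_le_mul_of_nonneg_left (hlyap x) hspos.le]
  have hA2 := Matrix.mulVec_dotProduct_self_le A2 x
  have hCp := Matrix.mulVec_dotProduct_self_le Cp x
  have hPB := Matrix.mulVec_dotProduct_self_le (P * B1) y
  have hcross : y ⬝ᵥ (B1ᵀ * P) *ᵥ x = x ⬝ᵥ (P * B1) *ᵥ y := by
    rw [Matrix.dotProduct_mulVec, ← Matrix.mulVec_transpose, Matrix.transpose_mul, hPsymm,
      Matrix.transpose_transpose, dotProduct_comm]
  have hyoung : 0 ≤ (x - (P * B1) *ᵥ y) ⬝ᵥ (x - (P * B1) *ᵥ y) := by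
    simpa using dotProduct_star_self_nonneg (x - (P * B1) *ᵥ y)
  have hy : 0 ≤ y ⬝ᵥ y := by simpa using dotProduct_star_self_nonneg y
  rw [sub_dotProduct, dotProduct_sub, dotProduct_sub, dotProduct_comm ((P * B1) *ᵥ y) x] at hyoung
  rw [Matrix.add_mulVec, dotProduct_add] at hlyap'
  simp only [Matrix.fromBlocks_mulVec, sumElim_dotProduct_sumElim,
    Sum.elim_comp_inl, Sum.elim_comp_inr,
    Matrix.add_mulVec, Matrix.smul_mulVec, dotProduct_add, dotProduct_smul, smul_eq_mul,
    Matrix.one_mulVec, Matrix.dotProduct_transpose_mul_self_mulVec, hcross, one_mul]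
  nlinarith
end

section
/- Let L ≥ 0, γ ≥ 0, η > 0 and set λ := √(γ² + η). Let a, d, h, w, ζ be real numbers with w ≥ 0, h ≥ 0 and ζ ≥ 0, and let v̇, ẇ be real numbers satisfying v̇ ≤ −a − h² − d + γ²w² and ẇ ≤ Lw + h. Then v̇ + λ(−2Lζ − λ(ζ² + 1))w² + 2λζw·ẇ ≤ −a − d − ηw². (This is the central estimate in the proof of Theorem 1: along the flow, the function R = V + λζ(τ)W²(e) decreases at rate at least α(|x|) + δ(y) + ηW²(e) whenever ζ(τ) ≥ 0, where v̇ plays the role of ⟨∇V(x), f(x,e)⟩, ẇ of ⟨∇W(e), g(x,e)⟩, a of α(|x|), h of H(x), d of δ(y), w of W(e), and ζ solves ζ̇ = −2Lζ − λ(ζ² + 1).) -/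
/-- The central estimate in the proof of Theorem 1: combining the dissipation inequality
`v̇ ≤ −a − h² − d + γ²w²`, the growth condition `ẇ ≤ Lw + h` and the Riccati equation
`ζ̇ = −2Lζ − λ(ζ² + 1)` with `λ = √(γ² + η)`, one gets
`v̇ + λ(−2Lζ − λ(ζ² + 1))w² + 2λζw·ẇ ≤ −a − d − ηw²` whenever `w, h, ζ ≥ 0`. -/
theorem central_flow_estimate (L γ η : ℝ) (hL : 0 ≤ L) (hγ : 0 ≤ γ) (hη : 0 < η)
    (lam : ℝ) (hlam : lam = Real.sqrt (γ ^ 2 + η))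
    (a d h w ζ vdot wdot : ℝ) (hw : 0 ≤ w) (hh : 0 ≤ h) (hζ : 0 ≤ ζ)
    (hv : vdot ≤ -a - h ^ 2 - d + γ ^ 2 * w ^ 2)
    (hwd : wdot ≤ L * w + h) :
    vdot + lam * (-2 * L * ζ - lam * (ζ ^ 2 + 1)) * w ^ 2 + 2 * lam * ζ * w * wdot ≤
      -a - d - η * w ^ 2 := by
  have hlam_nonneg : 0 ≤ lam := hlam ▸ Real.sqrt_nonneg _
  have hlam_sq : lam ^ 2 = γ ^ 2 + η := by
    rw [hlam, Real.sq_sqrt (by positivity)]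
  have hcross : 2 * lam * ζ * w * wdot ≤ 2 * lam * ζ * w * (L * w + h) :=
    mul_le_mul_of_nonneg_left hwd (by positivity)
  have hγ_sq : γ ^ 2 * w ^ 2 = lam ^ 2 * w ^ 2 - η * w ^ 2 := by
    rw [hlam_sq]; ring
  linarith [sq_nonneg (h - lam * ζ * w)]
end

section
/- Let L ≥ 0, λ > 0, θ ∈ (0, 1), and let ζ: [0, ∞) → ℝ be the solution of the ordinary differential equation ζ′(t) = −2Lζ(t) − λ(ζ(t)² + 1) with ζ(0) = θ⁻¹. Then: (i) ζ(t) ≤ θ⁻¹ for all t ≥ 0; (ii) ζ is strictly decreasing on any interval where ζ ≥ 0 (indeed ζ′(t) ≤ −λ < 0 whenever ζ(t) ≥ 0); and (iii) there exists a unique time T̃ > 0 such that ζ(T̃) = θ, and ζ(t) > θ for all t ∈ [0, T̃). -/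
open Set

/-- A nonnegative constant is an upper barrier for solutions of the Riccati equation. -/
theorem riccati_le_of_le {L lam : ℝ} (hL : 0 ≤ L) (hlam : 0 < lam) {ζ : ℝ → ℝ}
    (hode : ∀ t ≥ (0 : ℝ), HasDerivAt ζ (-2 * L * ζ t - lam * ((ζ t) ^ 2 + 1)) t)
    {c u t : ℝ} (hc : 0 ≤ c) (hu : 0 ≤ u) (hut : u ≤ t) (h : ζ u ≤ c) : ζ t ≤ c := by
  refine image_le_of_deriv_right_lt_deriv_boundary (a := u) (b := t) (B := fun _ => c)
    (B' := fun _ => 0)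
    (fun x hx => (hode x (hu.trans hx.1)).continuousAt.continuousWithinAt)
    (fun x hx => (hode x (hu.trans hx.1)).hasDerivWithinAt) h
    (fun x => hasDerivAt_const x c) (fun x _ hxc => ?_) (right_mem_Icc.2 hut)
  rw [hxc]
  nlinarith [mul_nonneg hL hc, mul_nonneg hlam.le (sq_nonneg c)]

/-- A solution of the Riccati equation decreases at rate at least `lam` while nonnegative. -/
theorem riccati_le_sub_mul {L lam : ℝ} (hL : 0 ≤ L) (hlam : 0 < lam) {ζ : ℝ → ℝ}
    (hode : ∀ t ≥ (0 : ℝ), HasDerivAt ζ (-2 * L * ζ t - lam * ((ζ t) ^ 2 + 1)) t)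
    {s t : ℝ} (hs : 0 ≤ s) (hst : s < t) (h : ∀ u ∈ Icc s t, 0 ≤ ζ u) :
    ζ t ≤ ζ s - lam * (t - s) := by
  obtain ⟨x, hx, he⟩ := exists_hasDerivAt_eq_slope ζ _ hst
    (fun x hx => (hode x (hs.trans hx.1)).continuousAt.continuousWithinAt)
    (fun x hx => hode x (hs.trans hx.1.le))
  rw [eq_div_iff (sub_pos.2 hst).ne'] at he
  have hx0 := h x (Ioo_subset_Icc_self hx)
  have hd : -2 * L * ζ x - lam * ((ζ x) ^ 2 + 1) ≤ -lam := by
    nlinarith [mul_nonneg hL hx0, mul_nonneg hlam.le (sq_nonneg (ζ x))]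
  linarith [mul_le_mul_of_nonneg_right hd (sub_pos.2 hst).le]

/-- A solution of the Riccati equation with a positive value at `t` is larger at earlier times. -/
theorem riccati_lt_of_lt {L lam : ℝ} (hL : 0 ≤ L) (hlam : 0 < lam) {ζ : ℝ → ℝ}
    (hode : ∀ t ≥ (0 : ℝ), HasDerivAt ζ (-2 * L * ζ t - lam * ((ζ t) ^ 2 + 1)) t)
    {s t : ℝ} (hs : 0 ≤ s) (hst : s < t) (ht : 0 < ζ t) : ζ t < ζ s := by
  have h : ∀ u ∈ Icc s t, 0 ≤ ζ u := fun u hu => by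
    by_contra! hneg
    exact absurd (riccati_le_of_le hL hlam hode le_rfl (hs.trans hu.1) hu.2 hneg.le) ht.not_ge
  linarith [riccati_le_sub_mul hL hlam hode hs hst h, mul_pos hlam (sub_pos.2 hst)]

/-- Properties of the solution `ζ` of the Riccati equation
`ζ' = −2Lζ − λ(ζ² + 1)`, `ζ(0) = θ⁻¹`, for `L ≥ 0`, `λ > 0`, `θ ∈ (0,1)`:
(i) `ζ(t) ≤ θ⁻¹` for all `t ≥ 0`;
(ii) `ζ'(t) ≤ −λ < 0` whenever `ζ(t) ≥ 0`, so `ζ` is strictly decreasing on any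
interval (contained in `[0,∞)`) where `ζ ≥ 0`;
(iii) there is a unique `T̃ > 0` with `ζ(T̃) = θ`, and `ζ(t) > θ` on `[0, T̃)`. -/
theorem riccati_solution_properties (L lam θ : ℝ) (hL : 0 ≤ L) (hlam : 0 < lam)
    (hθ : θ ∈ Set.Ioo (0 : ℝ) 1) (ζ : ℝ → ℝ) (hζ0 : ζ 0 = θ⁻¹)
    (hode : ∀ t ≥ (0 : ℝ), HasDerivAt ζ (-2 * L * ζ t - lam * ((ζ t) ^ 2 + 1)) t) :
    -- (i)
    (∀ t ≥ (0 : ℝ), ζ t ≤ θ⁻¹) ∧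
    -- (ii)
    (∀ t ≥ (0 : ℝ), 0 ≤ ζ t → deriv ζ t ≤ -lam) ∧
    (∀ s t : ℝ, 0 ≤ s → s < t → (∀ u ∈ Set.Icc s t, 0 ≤ ζ u) → ζ t < ζ s) ∧
    -- (iii)
    (∃! T : ℝ, 0 < T ∧ ζ T = θ) ∧
    (∀ T : ℝ, 0 < T → ζ T = θ → ∀ t ∈ Set.Ico (0 : ℝ) T, θ < ζ t) := by
  obtain ⟨hθ0, hθ1⟩ := hθ
  have hinv : 1 < θ⁻¹ := (one_lt_inv₀ hθ0).2 hθ1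
  have hlt : ∀ s t : ℝ, 0 ≤ s → s < t → ζ t = θ → θ < ζ s := fun s t hs hst ht =>
    ht ▸ riccati_lt_of_lt hL hlam hode hs hst (ht ▸ hθ0)
  refine ⟨fun t ht => riccati_le_of_le hL hlam hode (by linarith) le_rfl ht hζ0.le,
    fun t ht h0 => ?_, fun s t hs hst h => ?_, ?_,
    fun T _ hT t ht => hlt t T ht.1 ht.2 hT⟩
  · rw [(hode t ht).deriv]
    nlinarith [mul_nonneg hL h0, mul_nonneg hlam.le (sq_nonneg (ζ t))]
  · linarith [riccati_le_sub_mul hL hlam hode hs hst h, mul_pos hlam (sub_pos.2 hst)]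
  · have hb : 0 < θ⁻¹ / lam := by positivity
    have hle : ∃ b : ℝ, 0 ≤ b ∧ ζ b ≤ θ := by
      by_contra! hgt
      have h := riccati_le_sub_mul hL hlam hode le_rfl hb
        (fun u hu => hθ0.le.trans (hgt u hu.1).le)
      rw [hζ0, sub_zero, mul_div_cancel₀ _ hlam.ne'] at h
      linarith [hgt _ hb.le]
    obtain ⟨b, hb0, hbθ⟩ := hle
    obtain ⟨T, hT, hTθ⟩ := intermediate_value_Icc' hb0
      (fun x hx => (hode x hx.1).continuousAt.continuousWithinAt)
      (show θ ∈ Icc (ζ b) (ζ 0) from ⟨hbθ, by linarith⟩)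
    have hT0 : 0 < T := by
      refine hT.1.lt_of_ne fun h => ?_
      rw [← h, hζ0] at hTθ
      linarith
    refine ⟨T, ⟨hT0, hTθ⟩, fun S ⟨hS0, hSθ⟩ => ?_⟩
    rcases lt_trichotomy S T with h | h | h
    · exact absurd hSθ (hlt S T hS0.le h hTθ).ne'
    · exact h
    · exact absurd hTθ (hlt T S hT0.le h hSθ).ne'
end

section
/- Let L > 0 and γ > 0 be fixed. For θ ∈ (0, 1) and η > 0, set λ := √(γ² + η) and let T̃(θ, η) denote the unique time at which the solution ζ of ζ′ = −2Lζ − λ(ζ² + 1), ζ(0) = θ⁻¹, reaches the value θ. Then T̃(θ, η) → 𝒯(γ, L) as (θ, η) → (0⁺, 0⁺), where 𝒯(γ, L) := (1/(Lr))·arctan(r) if γ > L, 𝒯(γ, L) := 1/L if γ = L, and 𝒯(γ, L) := (1/(Lr))·artanh(r) if γ < L, with r := √|(γ/L)² − 1|. -/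
open Set Filter

/-- The inverse hyperbolic tangent `artanh r = ½ log((1+r)/(1−r))`. -/
noncomputable def artanh (r : ℝ) : ℝ := Real.log ((1 + r) / (1 - r)) / 2

/-- The maximum allowable sampling period `𝒯(γ, L)` of Nešić–Teel–Carnevale,
with `r := √|(γ/L)² − 1|`. -/
noncomputable def masp (γ L : ℝ) : ℝ :=
  if L < γ then 1 / (L * Real.sqrt |(γ / L) ^ 2 - 1|) * Real.arctan (Real.sqrt |(γ / L) ^ 2 - 1|)
  else if γ = L then 1 / L
  else 1 / (L * Real.sqrt |(γ / L) ^ 2 - 1|) * artanh (Real.sqrt |(γ / L) ^ 2 - 1|)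

open Topology

lemma sq_mul_sqrt_abs_div_sq_sub_one {γ L : ℝ} (hL : 0 < L) :
    (L * Real.sqrt |(γ / L) ^ 2 - 1|) ^ 2 = |γ ^ 2 - L ^ 2| := by
  rw [mul_pow, Real.sq_sqrt (abs_nonneg _)]
  conv_lhs => rw [← abs_of_pos (pow_pos hL 2)]
  rw [← abs_mul]
  congr 1
  field_simp

/-- `1 / (2Lx + γ(x² + 1))` has a primitive on `[0, ∞)` whose total increment is `masp γ L`. -/
lemma exists_primitive_tendsto_masp {L γ : ℝ} (hL : 0 < L) (hγ : 0 < γ) :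
    ∃ F : ℝ → ℝ, (∀ x, 0 ≤ x → HasDerivAt F (1 / (2 * L * x + γ * (x ^ 2 + 1))) x) ∧
      Tendsto F atTop (𝓝 (F 0 + masp γ L)) := by
  have hsq := sq_mul_sqrt_abs_div_sq_sub_one (γ := γ) hL
  unfold masp
  set r := Real.sqrt |(γ / L) ^ 2 - 1|
  have hr0 : 0 ≤ r := Real.sqrt_nonneg _
  have hlin (c : ℝ) : Tendsto (fun x : ℝ => γ * x + c) atTop atTop :=
    tendsto_atTop_add_const_right _ _ (tendsto_id.const_mul_atTop hγ)
  have hderiv (c x : ℝ) : HasDerivAt (fun x : ℝ => γ * x + c) γ x := by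
    simpa using ((hasDerivAt_id x).const_mul γ).add_const c
  rcases lt_trichotomy L γ with h | h | h
  · rw [if_pos h]
    rw [abs_of_pos (by nlinarith)] at hsq
    have hr : 0 < r := by
      rcases hr0.eq_or_lt with h0 | h0
      · rw [← h0] at hsq; nlinarith
      · exact h0
    refine ⟨fun x => 1 / (L * r) * Real.arctan ((γ * x + L) / (L * r)), fun x hx => ?_, ?_⟩
    · have hD : 0 < 2 * L * x + γ * (x ^ 2 + 1) := by positivity
      refine ((hderiv L x).div_const (L * r)).arctan.const_mul (1 / (L * r)) |>.congr_deriv ?_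
      have : 1 + ((γ * x + L) / (L * r)) ^ 2
          = γ * (2 * L * x + γ * (x ^ 2 + 1)) / (L * r) ^ 2 := by
        rw [div_pow, eq_div_iff (by positivity), add_mul, div_mul_cancel₀ _ (by positivity)]
        linear_combination hsq
      rw [this]
      field_simp
    · have h1 : Tendsto (fun x => Real.arctan ((γ * x + L) / (L * r))) atTop (𝓝 (Real.pi / 2)) :=
        (Real.tendsto_arctan_atTop.mono_right nhdsWithin_le_nhds).comp
          ((hlin L).atTop_div_const (by positivity))
      convert h1.const_mul (1 / (L * r)) using 2
      have h2 : (γ * 0 + L) / (L * r) = r⁻¹ := by field_simp; ring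
      beta_reduce
      rw [h2, Real.arctan_inv_of_pos hr]
      ring
  · subst h
    rw [if_neg (lt_irrefl _), if_pos rfl]
    refine ⟨fun x => -(L * x + L)⁻¹, fun x hx => ?_, ?_⟩
    · have hD : 0 < L * x + L := by positivity
      refine ((hderiv L x).inv hD.ne').neg.congr_deriv ?_
      have : 0 < 2 * L * x + L * (x ^ 2 + 1) := by positivity
      field_simp
      ring
    · have h1 : -(L * 0 + L)⁻¹ + 1 / L = -0 := by simp
      beta_reduce
      rw [h1]
      exact (tendsto_inv_atTop_zero.comp (hlin L)).neg
  · rw [if_neg h.not_gt, if_neg h.ne]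
    rw [abs_of_neg (by nlinarith)] at hsq
    have hr : 0 < r := by
      rcases hr0.eq_or_lt with h0 | h0
      · rw [← h0] at hsq; nlinarith
      · exact h0
    have haL : L * r < L := by nlinarith [mul_pos hL hr, pow_pos hγ 2]
    have hr1 : r < 1 := by nlinarith
    refine ⟨fun x => 1 / (L * r) * (Real.log (1 - 2 * (L * r) * (γ * x + (L + L * r))⁻¹) / 2),
      fun x hx => ?_, ?_⟩
    · have hD : 0 < 2 * L * x + γ * (x ^ 2 + 1) := by positivity
      have hp : 0 < γ * x + (L + L * r) := by positivity
      have hm : 0 < γ * x + (L - L * r) := by nlinarith [mul_nonneg hγ.le hx]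
      have hq : 1 - 2 * (L * r) * (γ * x + (L + L * r))⁻¹
          = (γ * x + (L - L * r)) / (γ * x + (L + L * r)) := by
        field_simp
        ring
      have hne : 1 - 2 * (L * r) * (γ * x + (L + L * r))⁻¹ ≠ 0 := by
        rw [hq]; positivity
      refine (((((hderiv (L + L * r) x).inv hp.ne').const_mul (2 * (L * r))).const_sub 1).log
        hne |>.div_const 2).const_mul (1 / (L * r)) |>.congr_deriv ?_
      have hprod : (γ * x + (L - L * r)) * (γ * x + (L + L * r))
          = γ * (2 * L * x + γ * (x ^ 2 + 1)) := by linear_combination -hsq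
      rw [Pi.inv_apply, hq]
      have : 2 * L * x + γ * (x ^ 2 + 1)
          = (γ * x + (L - L * r)) * (γ * x + (L + L * r)) / γ := by
        rw [hprod]; field_simp
      rw [this]
      field_simp
    · have h1 : Tendsto (fun x => 1 - 2 * (L * r) * (γ * x + (L + L * r))⁻¹) atTop (𝓝 1) := by
        simpa using ((tendsto_inv_atTop_zero.comp (hlin (L + L * r))).const_mul
          (2 * (L * r))).const_sub 1
      convert ((h1.log one_ne_zero).div_const 2).const_mul (1 / (L * r)) using 2
      have h2 : 1 - 2 * (L * r) * (γ * 0 + (L + L * r))⁻¹ = ((1 + r) / (1 - r))⁻¹ := by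
        have : 0 < 1 - r := by linarith
        rw [mul_zero, zero_add, show L + L * r = L * (1 + r) by ring]
        field_simp
        ring
      beta_reduce
      rw [h2, Real.log_inv, Real.log_one, artanh]
      ring

/-- A primitive `F` of `1 / (2Lx + γ(x² + 1))` decreases at a rate between `1` and `m / γ` along
a positive solution of `ζ' = -2Lζ - m(ζ² + 1)`, where `γ ≤ m`. -/
lemma riccati_time_bounds {L γ m τ : ℝ} {F ζ : ℝ → ℝ} (hL : 0 < L) (hγ : 0 < γ) (hm : γ ≤ m)
    (hτ : 0 < τ)
    (hF : ∀ x, 0 ≤ x → HasDerivAt F (1 / (2 * L * x + γ * (x ^ 2 + 1))) x)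
    (hζ : ∀ t ∈ Set.Icc 0 τ, HasDerivAt ζ (-2 * L * ζ t - m * ((ζ t) ^ 2 + 1)) t)
    (hpos : ∀ t ∈ Set.Icc 0 τ, 0 ≤ ζ t) :
    γ / m * (F (ζ 0) - F (ζ τ)) ≤ τ ∧ τ ≤ F (ζ 0) - F (ζ τ) := by
  have hd (t : ℝ) (ht : t ∈ Set.Icc 0 τ) := (hF _ (hpos t ht)).comp t (hζ t ht)
  obtain ⟨c, hc, hslope⟩ := exists_hasDerivAt_eq_slope (F ∘ ζ) _ hτ
    (fun t ht => (hd t ht).continuousAt.continuousWithinAt)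
    (fun t ht => hd t (Ioo_subset_Icc_self ht))
  have hz := hpos c (Ioo_subset_Icc_self hc)
  set z := ζ c
  have hD : 0 < 2 * L * z + γ * (z ^ 2 + 1) := by positivity
  have hm0 : 0 < m := hγ.trans_le hm
  rw [eq_div_iff (by linarith), sub_zero] at hslope
  simp only [Function.comp_apply] at hslope
  have heq : F (ζ 0) - F (ζ τ)
      = (2 * L * z + m * (z ^ 2 + 1)) / (2 * L * z + γ * (z ^ 2 + 1)) * τ := by
    rw [← neg_sub, ← hslope]
    field_simp
    ring
  rw [heq]
  constructor
  · rw [← mul_assoc]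
    refine mul_le_of_le_one_left hτ.le ?_
    rw [div_mul_div_comm, div_le_one (by positivity)]
    nlinarith [mul_nonneg (mul_nonneg hL.le hz) (sub_nonneg.2 hm)]
  · refine le_mul_of_one_le_left hτ.le ?_
    rw [one_le_div hD]
    nlinarith [mul_nonneg (sub_nonneg.2 hm) (by positivity : 0 ≤ z ^ 2 + 1)]

/-- The hitting time `T̃(θ, η)` — the time at which the solution of
`ζ' = −2Lζ − √(γ² + η)(ζ² + 1)`, `ζ(0) = θ⁻¹`, reaches `θ` — converges to the MASP
`𝒯(γ, L)` as `(θ, η) → (0⁺, 0⁺)`. -/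
theorem hitting_time_tendsto_masp (L γ : ℝ) (hL : 0 < L) (hγ : 0 < γ)
    (T : ℝ → ℝ → ℝ)
    (hT : ∀ θ η : ℝ, 0 < θ → θ < 1 → 0 < η →
      ∃ ζ : ℝ → ℝ, ζ 0 = θ⁻¹ ∧
        (∀ t ∈ Set.Icc (0 : ℝ) (T θ η),
          HasDerivAt ζ (-2 * L * ζ t - Real.sqrt (γ ^ 2 + η) * ((ζ t) ^ 2 + 1)) t) ∧
        0 < T θ η ∧ ζ (T θ η) = θ ∧ ∀ t ∈ Set.Ico (0 : ℝ) (T θ η), θ < ζ t) :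
    Filter.Tendsto (fun p : ℝ × ℝ => T p.1 p.2)
      ((nhdsWithin (0 : ℝ) (Set.Ioi 0)) ×ˢ (nhdsWithin (0 : ℝ) (Set.Ioi 0)))
      (nhds (masp γ L)) := by
  obtain ⟨F, hF, hFtop⟩ := exists_primitive_tendsto_masp hL hγ
  have hθ : Tendsto (fun p : ℝ × ℝ => p.1) (𝓝[>] (0 : ℝ) ×ˢ 𝓝[>] (0 : ℝ)) (𝓝[>] 0) :=
    tendsto_fst
  have hη : Tendsto (fun p : ℝ × ℝ => p.2) (𝓝[>] (0 : ℝ) ×ˢ 𝓝[>] (0 : ℝ)) (𝓝 0) :=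
    tendsto_snd.mono_right nhdsWithin_le_nhds
  have hupper : Tendsto (fun p : ℝ × ℝ => F p.1⁻¹ - F p.1)
      (𝓝[>] (0 : ℝ) ×ˢ 𝓝[>] (0 : ℝ)) (𝓝 (masp γ L)) := by
    have h0 := (hF 0 le_rfl).continuousAt.tendsto.comp (hθ.mono_right nhdsWithin_le_nhds)
    simpa using (hFtop.comp (tendsto_inv_nhdsGT_zero.comp hθ)).sub h0
  have hratio : Tendsto (fun p : ℝ × ℝ => γ / Real.sqrt (γ ^ 2 + p.2))
      (𝓝[>] (0 : ℝ) ×ˢ 𝓝[>] (0 : ℝ)) (𝓝 1) := by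
    have h := (tendsto_const_nhds (x := γ)).div (hη.const_add (γ ^ 2)).sqrt
      (by rw [add_zero, Real.sqrt_sq hγ.le]; exact hγ.ne')
    rwa [add_zero, Real.sqrt_sq hγ.le, div_self hγ.ne'] at h
  have hlower := hratio.mul hupper
  rw [one_mul] at hlower
  have hbounds : ∀ᶠ p : ℝ × ℝ in 𝓝[>] (0 : ℝ) ×ˢ 𝓝[>] (0 : ℝ),
      γ / Real.sqrt (γ ^ 2 + p.2) * (F p.1⁻¹ - F p.1) ≤ T p.1 p.2 ∧
        T p.1 p.2 ≤ F p.1⁻¹ - F p.1 := by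
    filter_upwards [hθ.eventually (Ioo_mem_nhdsGT one_pos),
      (tendsto_snd (f := 𝓝[>] (0 : ℝ)) (g := 𝓝[>] (0 : ℝ))).eventually self_mem_nhdsWithin]
      with p hp1 hp2
    obtain ⟨ζ, hζ0, hζ, hT0, hζT, hlt⟩ := hT p.1 p.2 hp1.1 hp1.2 hp2
    have hpos : ∀ t ∈ Set.Icc 0 (T p.1 p.2), 0 ≤ ζ t := fun t ht => by
      rcases ht.2.eq_or_lt with h | h
      · rw [h, hζT]; exact hp1.1.le
      · exact (hp1.1.trans (hlt t ⟨ht.1, h⟩)).le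
    have hm : γ ≤ Real.sqrt (γ ^ 2 + p.2) :=
      Real.le_sqrt_of_sq_le (le_add_of_nonneg_right (le_of_lt hp2))
    simpa only [hζ0, hζT] using riccati_time_bounds hL hγ hm hT0 hF hζ hpos
  exact tendsto_of_tendsto_of_tendsto_of_le_of_le' hlower hupper
    (hbounds.mono fun _ h => h.1) (hbounds.mono fun _ h => h.2)
end

section
/- Let L > 0 and γ > 0. Then the improper integral ∫₀^∞ ds / (2Ls + γ(s² + 1)) converges and equals 𝒯(γ, L), where 𝒯(γ, L) := (1/(Lr))·arctan(r) if γ > L, 𝒯(γ, L) := 1/L if γ = L, and 𝒯(γ, L) := (1/(Lr))·artanh(r) if γ < L, with r := √|(γ/L)² − 1|. -/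
open Set MeasureTheory

theorem hasDerivAt_artanh {x : ℝ} (hx : |x| < 1) : HasDerivAt artanh (1 - x ^ 2)⁻¹ x := by
  obtain ⟨h₁, h₂⟩ := abs_lt.mp hx
  have ha : 1 + x ≠ 0 := by linarith
  have hb : 1 - x ≠ 0 := by linarith
  have hc : 1 - x ^ 2 ≠ 0 := by
    rw [show 1 - x ^ 2 = (1 + x) * (1 - x) by ring]
    exact mul_ne_zero ha hb
  have h := (((((hasDerivAt_id x).const_add 1).div ((hasDerivAt_id x).const_sub 1) hb).log
    (div_ne_zero ha hb)).div_const 2)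
  refine h.congr_deriv ?_
  simp only [id, Pi.div_apply]
  field_simp
  ring

/-- The substitution `w = L s / (γ + L s)` maps `[0, ∞)` onto `[0, 1)` and turns the integral of
`1 / (2 L s + γ (s² + 1))` into that of `1 / (L (1 + ((γ / L)² - 1) w²))`. -/
theorem integral_eq_of_hasDerivAt {L γ : ℝ} (hL : 0 < L) (hγ : 0 < γ) {G : ℝ → ℝ}
    (hG : ∀ w ∈ Icc (0 : ℝ) 1, HasDerivAt G (1 + ((γ / L) ^ 2 - 1) * w ^ 2)⁻¹ w) :
    IntegrableOn (fun s : ℝ => (2 * L * s + γ * (s ^ 2 + 1))⁻¹) (Ioi (0 : ℝ)) ∧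
      ∫ s in Ioi (0 : ℝ), (2 * L * s + γ * (s ^ 2 + 1))⁻¹ = (G 1 - G 0) / L := by
  have hpos : ∀ s ∈ Ici (0 : ℝ), 0 < γ + L * s := fun s hs => by
    have : 0 ≤ L * s := mul_nonneg hL.le hs
    linarith
  have hderiv : ∀ s ∈ Ici (0 : ℝ), HasDerivAt (fun s => G (L * s / (γ + L * s)) / L)
      (2 * L * s + γ * (s ^ 2 + 1))⁻¹ s := by
    intro s hs
    have hd := hpos s hs
    have hs' : 0 ≤ s := hs
    have hlin : HasDerivAt (fun s : ℝ => L * s) L s := by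
      simpa using (hasDerivAt_id s).const_mul L
    have hw : L * s / (γ + L * s) ∈ Icc (0 : ℝ) 1 :=
      ⟨by positivity, (div_le_one hd).mpr (by linarith)⟩
    have h := ((hG _ hw).comp s (hlin.div (hlin.const_add γ) hd.ne')).div_const L
    refine h.congr_deriv ?_
    have hq : 2 * L * s + γ * (s ^ 2 + 1) ≠ 0 := by positivity
    have hden : 1 + ((γ / L) ^ 2 - 1) * (L * s / (γ + L * s)) ^ 2 =
        γ * (2 * L * s + γ * (s ^ 2 + 1)) / (γ + L * s) ^ 2 := by
      field_simp
      ring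
    rw [hden]
    field_simp
    ring
  have hlim : Filter.Tendsto (fun s => G (L * s / (γ + L * s)) / L) Filter.atTop
      (nhds (G 1 / L)) := by
    have hw : Filter.Tendsto (fun s : ℝ => L * s / (γ + L * s)) Filter.atTop (nhds 1) := by
      have h : Filter.Tendsto (fun s : ℝ => 1 - γ / (γ + L * s)) Filter.atTop (nhds (1 - 0)) :=
        tendsto_const_nhds.sub (Filter.Tendsto.const_div_atTop
          (Filter.tendsto_atTop_add_const_left _ _ (Filter.tendsto_id.const_mul_atTop hL)) γ)
      rw [sub_zero] at h
      refine h.congr' ?_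
      filter_upwards [Filter.eventually_ge_atTop 0] with s hs
      have := (hpos s hs).ne'
      field_simp
      ring
    exact ((hG 1 (by simp)).continuousAt.tendsto.comp hw).div_const L
  have hint : IntegrableOn (fun s : ℝ => (2 * L * s + γ * (s ^ 2 + 1))⁻¹) (Ioi (0 : ℝ)) :=
    integrableOn_Ioi_deriv_of_nonneg' hderiv (fun s hs => by
      have : 0 < s := hs
      positivity) hlim
  refine ⟨hint, ?_⟩
  rw [integral_Ioi_of_hasDerivAt_of_tendsto' hderiv hint hlim]
  simp [sub_div]

/-- For `L, γ > 0`, the improper integral `∫₀^∞ ds / (2Ls + γ(s² + 1))` converges and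
equals `𝒯(γ, L)`. -/
theorem integral_eq_masp (L γ : ℝ) (hL : 0 < L) (hγ : 0 < γ) :
    MeasureTheory.IntegrableOn (fun s : ℝ => (2 * L * s + γ * (s ^ 2 + 1))⁻¹)
        (Set.Ioi (0 : ℝ)) ∧
      ∫ s in Set.Ioi (0 : ℝ), (2 * L * s + γ * (s ^ 2 + 1))⁻¹ = masp γ L := by
  unfold masp
  have hg : 0 < γ / L := div_pos hγ hL
  split_ifs with h₁ h₂
  · have hk : 0 < (γ / L) ^ 2 - 1 := by
      have : 1 < γ / L := (one_lt_div hL).mpr h₁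
      nlinarith
    rw [abs_of_pos hk]
    set r := Real.sqrt ((γ / L) ^ 2 - 1)
    have hr0 : 0 < r := Real.sqrt_pos.mpr hk
    have hr2 : r ^ 2 = (γ / L) ^ 2 - 1 := Real.sq_sqrt hk.le
    convert integral_eq_of_hasDerivAt hL hγ (G := fun w => Real.arctan (r * w) / r) ?_ using 2
    · simp
      field_simp
    · intro w _
      refine ((((hasDerivAt_id w).const_mul r).arctan).div_const r).congr_deriv ?_
      have : 0 < 1 + r ^ 2 * w ^ 2 := by positivity
      simp only [id, ← hr2, mul_pow]
      field_simp
  · subst h₂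
    convert integral_eq_of_hasDerivAt hL hγ (G := id) ?_ using 2
    · simp
    · intro w _
      simpa [hL.ne'] using hasDerivAt_id w
  · have hlt : γ / L < 1 := (div_lt_one hL).mpr (lt_of_le_of_ne (not_lt.mp h₁) h₂)
    have hk : (γ / L) ^ 2 - 1 < 0 := by nlinarith
    rw [abs_of_neg hk]
    set r := Real.sqrt (-((γ / L) ^ 2 - 1))
    have hr0 : 0 < r := Real.sqrt_pos.mpr (by linarith)
    have hr2 : r ^ 2 = -((γ / L) ^ 2 - 1) := Real.sq_sqrt (by linarith)
    have hr1 : r < 1 := by nlinarith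
    convert integral_eq_of_hasDerivAt hL hγ (G := fun w => artanh (r * w) / r) ?_ using 2
    · simp [artanh]
      field_simp
    · intro w hw
      have hrw : |r * w| < 1 := by
        rw [abs_of_nonneg (mul_nonneg hr0.le hw.1)]
        nlinarith [hw.1, hw.2]
      refine (((hasDerivAt_artanh hrw).comp w
        ((hasDerivAt_id w).const_mul r)).div_const r).congr_deriv ?_
      rw [show (γ / L) ^ 2 - 1 = -r ^ 2 by linarith, mul_one,
        mul_div_cancel_right₀ _ hr0.ne']
      ring
end

section
/- Let ρ: [0, ∞) → [0, ∞) be continuous and positive definite (ρ(0) = 0 and ρ(s) > 0 for s > 0). Then there exists a class KL function β̃ such that every locally absolutely continuous function u: [0, ∞) → [0, ∞) satisfying u′(t) ≤ −ρ(u(t)) for almost all t ≥ 0 obeys u(t) ≤ β̃(u(0), t) for all t ≥ 0. -/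
open Set Filter MeasureTheory intervalIntegral

/-- A continuous function `α : [0,∞) → [0,∞)` is of class `K` if `α(0) = 0` and `α` is
strictly increasing. -/
def IsClassK (α : ℝ → ℝ) : Prop :=
  ContinuousOn α (Set.Ici 0) ∧ (∀ s ≥ (0 : ℝ), 0 ≤ α s) ∧ α 0 = 0 ∧
    StrictMonoOn α (Set.Ici 0)

/-- A continuous function `β : [0,∞) × [0,∞) → [0,∞)` is of class `KL` if `β(·, t)` is of
class `K` for each fixed `t ≥ 0` and, for each fixed `s ≥ 0`, `β(s, ·)` is decreasing
to zero. -/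
def IsClassKL (β : ℝ → ℝ → ℝ) : Prop :=
  ContinuousOn (fun p : ℝ × ℝ => β p.1 p.2) (Set.Ici 0 ×ˢ Set.Ici 0) ∧
  (∀ t ≥ (0 : ℝ), IsClassK (fun s => β s t)) ∧
  (∀ s ≥ (0 : ℝ), AntitoneOn (fun t => β s t) (Set.Ici 0) ∧
    Filter.Tendsto (fun t => β s t) Filter.atTop (nhds 0))

open Topology

/-- A continuous positive definite `ρ` admits an order isomorphism `W` of the line fixing the
origin whose logarithmic derivative is at least `1 / ρ` on the positive half-line. -/
lemma exists_orderIso_le_deriv_mul {ρ : ℝ → ℝ} (hρ_cont : ContinuousOn ρ (Ici 0))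
    (hρ_pos : ∀ s > (0 : ℝ), 0 < ρ s) :
    ∃ W : ℝ ≃o ℝ, W 0 = 0 ∧ ∀ s > 0, ∃ d, HasDerivAt W d s ∧ W s ≤ d * ρ s := by
  set g : ℝ → ℝ := fun r => (min (ρ r) r)⁻¹ with hg
  set G : ℝ → ℝ := fun s => ∫ r in (1 : ℝ)..s, g r with hG
  have hmin : ∀ r > 0, 0 < min (ρ r) r := fun r hr => lt_min (hρ_pos r hr) hr
  have hg_cont : ContinuousOn g (Ioi 0) :=
    ((hρ_cont.mono Ioi_subset_Ici_self).inf continuousOn_id).inv₀ fun r hr => (hmin r hr).ne'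
  have hG_deriv : ∀ s > 0, HasDerivAt G (g s) s := fun s hs => by
    refine integral_hasDerivAt_right ?_ (hg_cont.stronglyMeasurableAtFilter isOpen_Ioi s hs)
      (hg_cont.continuousAt (Ioi_mem_nhds hs))
    refine (hg_cont.mono fun x hx => ?_).intervalIntegrable
    exact (lt_min one_pos hs).trans_le hx.1
  have hmono : MonotoneOn (fun s => G s - Real.log s) (Ioi 0) := by
    have hd : ∀ s > 0, HasDerivAt (fun s => G s - Real.log s) (g s - s⁻¹) s := fun s hs =>
      (hG_deriv s hs).sub (Real.hasDerivAt_log hs.ne')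
    refine monotoneOn_of_deriv_nonneg (convex_Ioi 0)
      (fun s hs => (hd s hs).continuousAt.continuousWithinAt) ?_ ?_
    · rw [interior_Ioi]
      exact fun s hs => (hd s hs).differentiableAt.differentiableWithinAt
    · rw [interior_Ioi]
      intro s hs
      rw [(hd s hs).deriv, sub_nonneg]
      exact inv_anti₀ (hmin s hs) (min_le_right _ _)
  have hG1 : G 1 = 0 := integral_same
  have hG_strict : StrictMonoOn G (Ioi 0) := fun a ha b hb hab => by
    have h1 := hmono ha hb hab.le
    have h2 := Real.log_lt_log ha hab
    simp only at h1
    linarith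
  have hG_le : ∀ s > 0, s ≤ 1 → G s ≤ Real.log s := fun s hs h => by
    have := hmono hs (mem_Ioi.2 one_pos) h
    simp only [hG1, Real.log_one] at this
    linarith
  have hG_ge : ∀ s, 1 ≤ s → Real.log s ≤ G s := fun s h => by
    have := hmono (mem_Ioi.2 one_pos) (mem_Ioi.2 (one_pos.trans_le h)) h
    simp only [hG1, Real.log_one] at this
    linarith
  set w : ℝ → ℝ := fun s => if s ≤ 0 then s else Real.exp (G s) with hw
  have hw_np : ∀ s ≤ 0, w s = s := fun s hs => if_pos hs
  have hw_pos : ∀ s > 0, w s = Real.exp (G s) := fun s hs => if_neg hs.not_ge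
  have hw_deriv : ∀ s > 0, HasDerivAt w (Real.exp (G s) * g s) s := fun s hs =>
    (hG_deriv s hs).exp.congr_of_eventuallyEq <| by
      filter_upwards [Ioi_mem_nhds hs] with x hx using hw_pos x hx
  have hw_strict : StrictMono w := fun a b hab => by
    rcases le_or_gt b 0 with hb | hb
    · rwa [hw_np b hb, hw_np a (hab.le.trans hb)]
    rcases le_or_gt a 0 with ha | ha
    · rw [hw_np a ha, hw_pos b hb]
      exact ha.trans_lt (Real.exp_pos _)
    · rw [hw_pos a ha, hw_pos b hb]
      exact Real.exp_lt_exp.2 (hG_strict ha hb hab)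
  have hw_cont : Continuous w := by
    refine continuous_iff_continuousAt.2 fun s => ?_
    rcases lt_trichotomy s 0 with hs | rfl | hs
    · refine continuousAt_id.congr ?_
      filter_upwards [Iio_mem_nhds hs] with x hx using (hw_np x hx.le).symm
    · refine Metric.continuousAt_iff.2 fun ε hε => ⟨min ε 1, by positivity, fun {x} hx => ?_⟩
      rw [hw_np 0 le_rfl]
      rw [Real.dist_eq, sub_zero] at hx ⊢
      refine lt_of_le_of_lt ?_ (hx.trans_le (min_le_left _ _))
      rcases le_or_gt x 0 with h | h
      · rw [hw_np x h]
      · rw [hw_pos x h, Real.abs_exp, abs_of_pos h]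
        rw [abs_of_pos h] at hx
        calc Real.exp (G x) ≤ Real.exp (Real.log x) :=
              Real.exp_le_exp.2 (hG_le x h (hx.le.trans (min_le_right _ _)))
          _ = x := Real.exp_log h
    · exact (hw_deriv s hs).continuousAt
  have hw_surj : Function.Surjective w := by
    refine hw_cont.surjective ?_ ?_
    · refine tendsto_atTop_mono' _ ?_ tendsto_id
      filter_upwards [eventually_ge_atTop 1] with x hx
      have h0 : 0 < x := one_pos.trans_le hx
      rw [hw_pos x h0, id, ← Real.log_le_iff_le_exp h0]
      exact hG_ge x hx
    · refine tendsto_id.congr' ?_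
      filter_upwards [eventually_le_atBot 0] with x hx using (hw_np x hx).symm
  refine ⟨hw_strict.orderIsoOfSurjective w hw_surj, hw_np 0 le_rfl, fun s hs =>
    ⟨_, hw_deriv s hs, ?_⟩⟩
  change w s ≤ _
  rw [hw_pos s hs, mul_assoc]
  refine le_mul_of_one_le_right (Real.exp_pos _).le ?_
  rw [hg, inv_mul_eq_div, one_le_div (hmin s hs)]
  exact min_le_left _ _

/-- Along a nonnegative solution of the integral inequality `u(t) ≤ u(s) - ∫ₛᵗ ρ(u(r)) dr`, a
strictly increasing `W` with `W ≤ W' ρ` decays exponentially. -/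
lemma le_exp_neg_mul_of_le_sub_integral {ρ u : ℝ → ℝ} {W : ℝ → ℝ}
    (hρ_cont : ContinuousOn ρ (Ici 0)) (hρ_nonneg : ∀ s ≥ (0 : ℝ), 0 ≤ ρ s)
    (hW_mono : StrictMono W) (hW0 : W 0 = 0)
    (hW : ∀ s > 0, ∃ d, HasDerivAt W d s ∧ W s ≤ d * ρ s)
    (hu_cont : ContinuousOn u (Ici 0)) (hu_nonneg : ∀ t ≥ (0 : ℝ), 0 ≤ u t)
    (hu : ∀ s t : ℝ, 0 ≤ s → s ≤ t → u t ≤ u s - ∫ r in s..t, ρ (u r))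
    {t : ℝ} (ht : 0 ≤ t) : W (u t) ≤ Real.exp (-t) * W (u 0) := by
  have hW_nonneg : ∀ s ≥ 0, 0 ≤ W s := fun s hs => hW0 ▸ hW_mono.monotone hs
  have hW_pos : ∀ s > 0, 0 < W s := fun s hs => hW0 ▸ hW_mono hs
  rcases (hu_nonneg t ht).eq_or_lt with h0 | hpos
  · rw [← h0, hW0]
    exact mul_nonneg (Real.exp_pos _).le (hW_nonneg _ (hu_nonneg 0 le_rfl))
  have hanti : ∀ s r : ℝ, 0 ≤ s → s ≤ r → u r ≤ u s := fun s r hs hsr =>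
    (hu s r hs hsr).trans <| sub_le_self _ <| integral_nonneg hsr fun x hx =>
      hρ_nonneg _ (hu_nonneg x (hs.trans hx.1))
  have hu_pos : ∀ s ∈ Icc 0 t, 0 < u s := fun s hs => hpos.trans_le (hanti s t hs.1 hs.2)
  set q : ℝ → ℝ := fun r => ρ (u (max r 0)) with hq
  have hq_cont : Continuous q :=
    hρ_cont.comp_continuous
      (hu_cont.comp_continuous (by fun_prop) fun r => le_max_right r 0)
      fun r => hu_nonneg _ (le_max_right r 0)
  have key : ∀ ⦃x⦄, x ∈ Icc 0 t → Real.log (W (u x)) ≤ Real.log (W (u 0)) - x := by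
    refine image_le_of_liminf_slope_right_le_deriv_boundary (B' := fun _ => -1) ?_ (by simp)
      (by fun_prop) (fun x _ => ?_) ?_
    · intro s hs
      obtain ⟨d, hd, -⟩ := hW _ (hu_pos s hs)
      exact (hd.continuousAt.comp_continuousWithinAt
        (hu_cont.mono Icc_subset_Ici_self s hs)).log (hW_pos _ (hu_pos s hs)).ne'
    · simpa using ((hasDerivAt_id x).const_sub (Real.log (W (u 0)))).hasDerivWithinAt
    · intro x hx r hr
      have hux := hu_pos x ⟨hx.1, hx.2.le⟩
      obtain ⟨d, hd, hdρ⟩ := hW _ hux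
      set Y : ℝ → ℝ := fun z => u x - ∫ y in x..z, q y with hY
      have hYx : Y x = u x := by simp [hY]
      have hqx : q x = ρ (u x) := by simp [hq, max_eq_left hx.1]
      have hY_deriv : HasDerivAt Y (-(ρ (u x))) x := by
        rw [← hqx]
        exact (hq_cont.integral_hasStrictDerivAt x x).hasDerivAt.const_sub _
      have hcomp : HasDerivAt (fun z => Real.log (W (Y z))) (d * -(ρ (u x)) / W (u x)) x := by
        have hd' : HasDerivAt W d (Y x) := hYx.symm ▸ hd
        have := (hd'.comp x hY_deriv).log (by simpa [hYx] using (hW_pos _ hux).ne')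
        simpa [hYx] using this
      have hlt : d * -(ρ (u x)) / W (u x) < r := by
        refine lt_of_le_of_lt ?_ hr
        rw [div_le_iff₀ (hW_pos _ hux)]
        linarith
      have hslope := (hasDerivAt_iff_tendsto_slope.1 hcomp).mono_left
        (nhdsWithin_mono x (show Ioi x ⊆ {x}ᶜ from fun z hz => (ne_of_gt hz)))
      refine Eventually.frequently ?_
      filter_upwards [hslope.eventually_lt_const hlt, Ioo_mem_nhdsGT hx.2] with z hz hxz
      refine lt_of_le_of_lt ?_ hz
      have huz := hu_pos z ⟨hx.1.trans hxz.1.le, hxz.2.le⟩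
      have hle : u z ≤ Y z := by
        refine (hu x z hx.1 hxz.1.le).trans_eq ?_
        rw [hY]
        congr 1
        refine integral_congr fun y hy => ?_
        rw [uIcc_of_le hxz.1.le] at hy
        simp [hq, max_eq_left (hx.1.trans hy.1)]
      rw [slope_def_field, slope_def_field, hYx]
      have hzx : 0 < z - x := sub_pos.2 hxz.1
      have := Real.log_le_log (hW_pos _ huz) (hW_mono.monotone hle)
      gcongr
  have h := key ⟨ht, le_rfl⟩
  have hWt := hW_pos _ hpos
  have hW0' := hW_pos _ (hu_pos 0 ⟨le_rfl, ht⟩)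
  rw [Real.log_le_iff_le_exp hWt, sub_eq_neg_add, Real.exp_add, Real.exp_log hW0'] at h
  exact h

/-- Conjugating exponential decay by an order isomorphism fixing the origin gives a class `KL`
function. -/
lemma isClassKL_symm_exp_neg_mul (W : ℝ ≃o ℝ) (hW0 : W 0 = 0) :
    IsClassKL fun s t => W.symm (Real.exp (-t) * W s) := by
  have hWs0 : W.symm 0 = 0 := by rw [← hW0, W.symm_apply_apply, hW0]
  have hW_nonneg : ∀ s ≥ 0, 0 ≤ W s := fun s hs => hW0 ▸ W.monotone hs
  have hW := W.continuous
  have hWs := W.symm.continuous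
  refine ⟨by fun_prop, fun t _ => ⟨by fun_prop, fun s hs => ?_, by simp [hW0, hWs0], ?_⟩,
    fun s hs => ⟨fun a _ b _ hab => ?_, ?_⟩⟩
  · rw [← hWs0]
    exact W.symm.monotone (mul_nonneg (Real.exp_pos _).le (hW_nonneg s hs))
  · exact fun a _ b _ hab => W.symm.strictMono
      (mul_lt_mul_of_pos_left (W.strictMono hab) (Real.exp_pos _))
  · exact W.symm.monotone (mul_le_mul_of_nonneg_right
      (Real.exp_le_exp.2 (neg_le_neg hab)) (hW_nonneg s hs))
  · have h : Tendsto (fun t => Real.exp (-t) * W s) atTop (𝓝 0) := by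
      simpa using Real.tendsto_exp_neg_atTop_nhds_zero.mul_const (W s)
    simpa [hWs0, Function.comp_def] using (hWs.tendsto 0).comp h

/-- Comparison lemma: for every continuous positive definite `ρ : [0,∞) → [0,∞)` there is
a class `KL` function `β̃` such that every (locally absolutely continuous, nonnegative)
function `u` satisfying the differential inequality `u' ≤ −ρ(u)` a.e. on `[0,∞)` — here
encoded in its equivalent integral form `u(t) ≤ u(s) − ∫ₛᵗ ρ(u(r)) dr` for all
`0 ≤ s ≤ t` — obeys `u(t) ≤ β̃(u(0), t)` for all `t ≥ 0`. -/
theorem comparison_KL (ρ : ℝ → ℝ) (hρ_cont : ContinuousOn ρ (Set.Ici 0))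
    (hρ_nonneg : ∀ s ≥ (0 : ℝ), 0 ≤ ρ s) (hρ0 : ρ 0 = 0)
    (hρ_pos : ∀ s > (0 : ℝ), 0 < ρ s) :
    ∃ β : ℝ → ℝ → ℝ, IsClassKL β ∧
      ∀ u : ℝ → ℝ, ContinuousOn u (Set.Ici 0) → (∀ t ≥ (0 : ℝ), 0 ≤ u t) →
        (∀ s t : ℝ, 0 ≤ s → s ≤ t → u t ≤ u s - ∫ r in s..t, ρ (u r)) →
        ∀ t ≥ (0 : ℝ), u t ≤ β (u 0) t := by
  obtain ⟨W, hW0, hW⟩ := exists_orderIso_le_deriv_mul hρ_cont hρ_pos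
  refine ⟨_, isClassKL_symm_exp_neg_mul W hW0, fun u hu_cont hu_nonneg hu t ht => ?_⟩
  rw [OrderIso.le_symm_apply]
  exact le_exp_neg_mul_of_le_sub_integral hρ_cont hρ_nonneg W.strictMono hW0 hW hu_cont hu_nonneg
    hu ht
end

section
/- Let α̲, ᾱ be class K∞ functions, let V: ℝⁿ → [0, ∞) satisfy α̲(|x|) ≤ V(x) ≤ ᾱ(|x|) for all x ∈ ℝⁿ, and let α: [0, ∞) → [0, ∞) be continuous and positive definite. Then there exists a continuous positive definite function ρ: [0, ∞) → [0, ∞) such that α(|x|) ≥ ρ(V(x)) for all x ∈ ℝⁿ. -/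
open Set Filter

/-- A class `K` function is of class `K∞` if in addition it tends to `∞` at `∞`. -/
def IsClassKInf (α : ℝ → ℝ) : Prop :=
  IsClassK α ∧ Filter.Tendsto α Filter.atTop Filter.atTop

/-- A class `K` function takes arbitrarily small values at positive points. -/
theorem IsClassK.exists_pos_lt {α : ℝ → ℝ} (hα : IsClassK α) {ε : ℝ} (hε : 0 < ε) :
    ∃ a > 0, α a < ε := by
  obtain ⟨hcont, -, h0, -⟩ := hα
  have hlim : ∀ᶠ r in nhdsWithin 0 (Ici 0), α r < ε :=
    (hcont 0 self_mem_Ici).eventually_lt_const (by rwa [h0])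
  have hlim' : ∀ᶠ r in nhdsWithin (0 : ℝ) (Ioi 0), α r < ε :=
    hlim.filter_mono (nhdsWithin_mono 0 Ioi_subset_Ici_self)
  obtain ⟨a, ha, ha'⟩ := (hlim'.and self_mem_nhdsWithin).exists
  exact ⟨a, ha', ha⟩

/-- If `α_low(|x|) ≤ V(x) ≤ α_up(|x|)` with `α_low, α_up ∈ K∞` and `α` is continuous and
positive definite, then there is a continuous positive definite `ρ` with
`ρ(V(x)) ≤ α(|x|)` for all `x`. -/
theorem exists_rho_of_sandwich {n : ℕ}
    (αlow αup : ℝ → ℝ) (hαlow : IsClassKInf αlow) (hαup : IsClassKInf αup)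
    (V : EuclideanSpace ℝ (Fin n) → ℝ) (hV_nonneg : ∀ x, 0 ≤ V x)
    (hsand : ∀ x, αlow ‖x‖ ≤ V x ∧ V x ≤ αup ‖x‖)
    (α : ℝ → ℝ) (hα_cont : ContinuousOn α (Set.Ici 0))
    (hα_nonneg : ∀ s ≥ (0 : ℝ), 0 ≤ α s) (hα0 : α 0 = 0)
    (hα_pos : ∀ s > (0 : ℝ), 0 < α s) :
    ∃ ρ : ℝ → ℝ, ContinuousOn ρ (Set.Ici 0) ∧ (∀ s ≥ (0 : ℝ), 0 ≤ ρ s) ∧ ρ 0 = 0 ∧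
      (∀ s > (0 : ℝ), 0 < ρ s) ∧ ∀ x, ρ (V x) ≤ α ‖x‖ := by
  let S : Set (ℝ × ℝ) := range fun x => (V x, α ‖x‖)
  have hS : S.Nonempty := range_nonempty _
  have hV0 : V 0 = 0 := by
    refine le_antisymm ?_ (hV_nonneg 0)
    simpa [hαup.1.2.2.1] using (hsand 0).2
  refine ⟨fun v => Metric.infDist (v, 0) S, ?_, fun s _ => Metric.infDist_nonneg, ?_, ?_, ?_⟩
  · exact ((Metric.continuous_infDist_pt S).comp (by fun_prop)).continuousOn
  · exact Metric.infDist_zero_of_mem ⟨0, by simp [hV0, hα0]⟩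
  · intro v hv
    obtain ⟨a, ha, hav⟩ := hαup.1.exists_pos_lt (half_pos hv)
    obtain ⟨b, hbv, hab⟩ :=
      ((hαlow.2.eventually_gt_atTop (2 * v)).and (eventually_ge_atTop a)).exists
    obtain ⟨c, hc, hmin⟩ := isCompact_Icc.exists_isMinOn (nonempty_Icc.2 hab)
      (hα_cont.mono fun r hr => ha.le.trans hr.1)
    have hαc : 0 < α c := hα_pos c (ha.trans_le hc.1)
    refine (lt_min (half_pos hv) hαc).trans_le ((Metric.le_infDist hS).2 ?_)
    rintro _ ⟨x, rfl⟩
    rw [Prod.dist_eq, Real.dist_eq, Real.dist_eq]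
    by_cases hx : ‖x‖ ∈ Icc a b
    · refine (min_le_right _ _).trans (le_max_of_le_right ?_)
      rw [zero_sub, abs_neg]
      exact (hmin hx).trans (le_abs_self _)
    · refine (min_le_left _ _).trans (le_max_of_le_left (le_abs.2 ?_))
      rw [mem_Icc, not_and_or, not_le, not_le] at hx
      rcases hx with hx | hx
      · left
        have := hαup.1.2.2.2 (norm_nonneg x) ha.le hx
        linarith [(hsand x).2]
      · right
        have := hαlow.1.2.2.2 (ha.le.trans hab) (norm_nonneg x) hx
        linarith [(hsand x).1]
  · intro x
    refine (Metric.infDist_le_dist_of_mem (mem_range_self x)).trans ?_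
    simp [Prod.dist_eq, abs_of_nonneg (hα_nonneg _ (norm_nonneg x)),
      hα_nonneg _ (norm_nonneg x)]
end

section
/- Consider the controlled Lorenz equations ẋ₁ = −a x₁ + a x₂, ẋ₂ = b x₁ − x₂ − x₁x₃ + u, ẋ₃ = x₁x₂ − c x₃ with constants a, b, c > 0 and output y = x₁, in closed loop with the static output feedback u = −((p₁/p₂)a + b)x₁, where p₁, p₂ > 0. Then the function V(x) = p₁x₁² + p₂x₂² + p₂x₃² satisfies, for all x = (x₁, x₂, x₃) ∈ ℝ³, ⟨∇V(x), f(x)⟩ = −2a p₁ x₁² − 2p₂ x₂² − 2c p₂ x₃² ≤ −2 min{a p₁, p₂, c p₂}(x₁² + x₂² + x₃²), where f denotes the closed-loop vector field; in particular V strictly decreases along all nonzero closed-loop trajectories. -/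
/-- Lorenz example: along the closed-loop vector field
`f(x) = (−a x₁ + a x₂, b x₁ − x₂ − x₁x₃ − ((p₁/p₂)a + b)x₁, x₁x₂ − c x₃)`,
the Lyapunov function `V(x) = p₁x₁² + p₂x₂² + p₂x₃²` (with gradient
`∇V(x) = (2p₁x₁, 2p₂x₂, 2p₂x₃)`) satisfies
`⟨∇V(x), f(x)⟩ = −2ap₁x₁² − 2p₂x₂² − 2cp₂x₃² ≤ −2 min{ap₁, p₂, cp₂} |x|²`;
in particular `V` strictly decreases along all nonzero closed-loop trajectories. -/
theorem lorenz_lyapunov_decrease (a b c p₁ p₂ : ℝ)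
    (ha : 0 < a) (hb : 0 < b) (hc : 0 < c) (hp₁ : 0 < p₁) (hp₂ : 0 < p₂)
    (x₁ x₂ x₃ : ℝ) :
    (2 * p₁ * x₁) * (-a * x₁ + a * x₂)
        + (2 * p₂ * x₂) * (b * x₁ - x₂ - x₁ * x₃ - ((p₁ / p₂) * a + b) * x₁)
        + (2 * p₂ * x₃) * (x₁ * x₂ - c * x₃)
      = -2 * a * p₁ * x₁ ^ 2 - 2 * p₂ * x₂ ^ 2 - 2 * c * p₂ * x₃ ^ 2 ∧
    (2 * p₁ * x₁) * (-a * x₁ + a * x₂)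
        + (2 * p₂ * x₂) * (b * x₁ - x₂ - x₁ * x₃ - ((p₁ / p₂) * a + b) * x₁)
        + (2 * p₂ * x₃) * (x₁ * x₂ - c * x₃)
      ≤ -2 * min (a * p₁) (min p₂ (c * p₂)) * (x₁ ^ 2 + x₂ ^ 2 + x₃ ^ 2) ∧
    ((x₁, x₂, x₃) ≠ (0, 0, 0) →
      (2 * p₁ * x₁) * (-a * x₁ + a * x₂)
          + (2 * p₂ * x₂) * (b * x₁ - x₂ - x₁ * x₃ - ((p₁ / p₂) * a + b) * x₁)
          + (2 * p₂ * x₃) * (x₁ * x₂ - c * x₃) < 0) := by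
  have hV : (2 * p₁ * x₁) * (-a * x₁ + a * x₂)
        + (2 * p₂ * x₂) * (b * x₁ - x₂ - x₁ * x₃ - ((p₁ / p₂) * a + b) * x₁)
        + (2 * p₂ * x₃) * (x₁ * x₂ - c * x₃)
      = -2 * a * p₁ * x₁ ^ 2 - 2 * p₂ * x₂ ^ 2 - 2 * c * p₂ * x₃ ^ 2 := by
    field_simp
    ring
  rw [hV]
  set m := min (a * p₁) (min p₂ (c * p₂))
  have hm_pos : 0 < m := by positivity
  have hm₁ : m ≤ a * p₁ := min_le_left _ _
  have hm₂ : m ≤ p₂ := (min_le_right _ _).trans (min_le_left _ _)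
  have hm₃ : m ≤ c * p₂ := (min_le_right _ _).trans (min_le_right _ _)
  have hle : -2 * a * p₁ * x₁ ^ 2 - 2 * p₂ * x₂ ^ 2 - 2 * c * p₂ * x₃ ^ 2
      ≤ -2 * m * (x₁ ^ 2 + x₂ ^ 2 + x₃ ^ 2) := by
    linarith [mul_le_mul_of_nonneg_right hm₁ (sq_nonneg x₁),
      mul_le_mul_of_nonneg_right hm₂ (sq_nonneg x₂),
      mul_le_mul_of_nonneg_right hm₃ (sq_nonneg x₃)]
  refine ⟨rfl, hle, fun hx => ?_⟩
  have hnorm : 0 < x₁ ^ 2 + x₂ ^ 2 + x₃ ^ 2 := by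
    have h : x₁ ≠ 0 ∨ x₂ ≠ 0 ∨ x₃ ≠ 0 := by
      contrapose! hx
      simp [hx]
    rcases h with h | h | h <;> positivity
  linarith [mul_pos hm_pos hnorm]
end
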